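/- Let n ≥ 6 be an integer with n ≡ 2 (mod 4) (i.e. v_2(n) = 1). Then, in ℚ[c_1,…,c_n], B̂_n/n ≡ −(1/(2n))·c_1^n + (n/2 − 1)·c_1^{n−3}c_3 + (3(n−4)/4)·c_1^{n−6}c_3^2 − c_1^{n−2}c_2 + 2·c_1^{n−5}(c_2c_3 + c_1c_4) (mod 4ℤ_2[c_1,…,c_n]), i.e. every coefficient of the difference of the two sides has v_2 ≥ 2. -/

import Mathlib

open Finsupp MvPolynomial

noncomputable section

/-- weight of a partition (given as the multiplicity function of its parts) -/
def wt (u : ℕ →₀ ℕ) : ℕ := u.sum fun i m => i * m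

/-- degree (number of parts) -/
def deg (u : ℕ →₀ ℕ) : ℕ := u.sum fun _ m => m

/-- γ_u = Π_i (i+1)^{u_i} (u_i)! -/
def gam (u : ℕ →₀ ℕ) : ℕ := u.prod fun i m => (i + 1) ^ m * m.factorial

/-- τ_u = (−1)^{d(u)−1} (w(u)+d(u)−2)! / γ_u -/
def tau (u : ℕ →₀ ℕ) : ℚ :=
  (-1 : ℚ) ^ (deg u - 1) * (Nat.factorial (wt u + deg u - 2) : ℚ) / (gam u : ℚ)

/-- p-adic valuation on ℚ with v_p(0) = ⊤ -/
def pval (p : ℕ) (x : ℚ) : WithTop ℤ :=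
  if x = 0 then ⊤ else ((padicValRat p x : ℤ) : WithTop ℤ)

/-- divided universal Bernoulli number B̂_n/n = Σ_{w(u)=n} τ_u c^u, as a
multivariate polynomial in the variables c_1, c_2, … (variable i is c_i). -/
def divB (n : ℕ) : MvPolynomial ℕ ℚ :=
  ∑ P : n.Partition, (tau P.parts.toFinsupp) • MvPolynomial.monomial P.parts.toFinsupp (1 : ℚ)

/-- F ≡ G (mod p^t ℤ_p[c_1,…]) : every coefficient of F − G has v_p ≥ t -/
def PCong (p t : ℕ) (F G : MvPolynomial ℕ ℚ) : Prop :=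
  ∀ u : ℕ →₀ ℕ, ((t : ℤ) : WithTop ℤ) ≤ pval p (MvPolynomial.coeff u (F - G))

open scoped Nat

local notation "ν" => padicValNat 2

lemma padicValNat_two_mono {a b : ℕ} (hb : b ≠ 0) (h : a ∣ b) : ν a ≤ ν b :=
  (padicValNat_dvd_iff_le hb).1 (pow_padicValNat_dvd.trans h)

lemma padicValNat_two_mul {a b : ℕ} (ha : a ≠ 0) (hb : b ≠ 0) : ν (a * b) = ν a + ν b :=
  padicValNat.mul ha hb

lemma le_padicValNat_two {k n : ℕ} (hn : n ≠ 0) (h : 2 ^ k ∣ n) : k ≤ ν n :=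
  (padicValNat_dvd_iff_le hn).1 h

lemma padicValNat_two_odd {n : ℕ} (h : n % 2 = 1) : ν n = 0 :=
  padicValNat.eq_zero_of_not_dvd (by omega)

lemma padicValNat_two_double {n : ℕ} (h : n ≠ 0) : ν (2 * n) = ν n + 1 := by
  rw [padicValNat_two_mul two_ne_zero h, padicValNat_self, add_comm]

lemma padicValNat_two_factorial_add (a b : ℕ) : ν a ! + ν b ! ≤ ν (a + b)! := by
  rw [← padicValNat_two_mul (Nat.factorial_ne_zero _) (Nat.factorial_ne_zero _)]
  exact padicValNat_two_mono (Nat.factorial_ne_zero _)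
    (Nat.factorial_mul_factorial_dvd_factorial_add a b)

lemma padicValNat_two_factorial_mono {a b : ℕ} (h : a ≤ b) : ν a ! ≤ ν b ! :=
  padicValNat_two_mono (Nat.factorial_ne_zero _) (Nat.factorial_dvd_factorial h)

lemma padicValNat_two_factorial_succ (a : ℕ) : ν (a + 1)! = ν (a + 1) + ν a ! := by
  rw [Nat.factorial_succ, padicValNat_two_mul (by omega) (Nat.factorial_ne_zero _)]

lemma padicValNat_two_factorial_double (a : ℕ) : ν (2 * a)! = a + ν a ! := by
  rw [padicValNat_factorial_mul, add_comm]

lemma padicValNat_two_factorial_four : ν 4 ! = 3 := by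
  rw [show 4 = 2 * (2 * 1) by rfl, padicValNat_two_factorial_double,
    padicValNat_two_factorial_double]
  simp

lemma three_le_padicValNat_two_factorial {a : ℕ} (h : 4 ≤ a) : 3 ≤ ν a ! :=
  padicValNat_two_factorial_four ▸ padicValNat_two_factorial_mono h

lemma pow_padicValNat_two_le {m : ℕ} (hm : m ≠ 0) : 2 ^ ν m ≤ m :=
  Nat.le_of_dvd (Nat.pos_of_ne_zero hm) pow_padicValNat_dvd

lemma padicValNat_two_lt {m : ℕ} (hm : m ≠ 0) : ν m < m :=
  Nat.lt_two_pow_self.trans_le (pow_padicValNat_two_le hm)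

lemma padicValNat_two_add_four_le {m : ℕ} (hm : 5 ≤ m) : ν m + 4 ≤ m := by
  have hd : 2 ^ ν m ∣ m := pow_padicValNat_dvd
  have h1 : 2 ^ ν m ≤ m := pow_padicValNat_two_le (by omega)
  obtain h | h | h | ⟨k, hk⟩ : ν m = 0 ∨ ν m = 1 ∨ ν m = 2 ∨ ∃ k, ν m = k + 3 := by
    rcases Nat.lt_or_ge (ν m) 3 with h | h
    · omega
    · exact Or.inr (Or.inr (Or.inr ⟨ν m - 3, by omega⟩))
  · rw [h] at hd ⊢; omega
  · rw [h] at hd ⊢; omega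
  · rw [h] at hd ⊢; omega
  · rw [hk] at h1 ⊢
    have : k + 1 ≤ 2 ^ k := Nat.lt_two_pow_self
    rw [pow_add] at h1
    omega

/-- A set of `(i + 1) * m` elements splits into `m` blocks of `i + 1` elements. -/
lemma pow_factorial_mul_factorial_dvd (i m : ℕ) : (i + 1)! ^ m * m ! ∣ ((i + 1) * m)! := by
  rw [mul_comm (i + 1) m, ← Nat.uniformBell_mul_eq m (Nat.succ_ne_zero i), mul_assoc]
  exact dvd_mul_left _ _

lemma padicValNat_two_block_le (i m : ℕ) :
    m * ν i ! + (m * ν (i + 1) + ν m !) ≤ ν ((i + 1) * m)! := by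
  refine le_trans (le_of_eq ?_)
    (padicValNat_two_mono (Nat.factorial_ne_zero _) (pow_factorial_mul_factorial_dvd i m))
  rw [padicValNat_two_mul (pow_ne_zero _ (Nat.factorial_ne_zero _)) (Nat.factorial_ne_zero _),
    padicValNat.pow, padicValNat_two_factorial_succ]
  ring

lemma padicValNat_two_factor (i m : ℕ) : ν ((i + 1) ^ m * m !) = m * ν (i + 1) + ν m ! := by
  rw [padicValNat_two_mul (pow_ne_zero _ i.succ_ne_zero) (Nat.factorial_ne_zero _),
    padicValNat.pow]

lemma padicValNat_two_succ_add_two_le {i : ℕ} (hi : 5 ≤ i) (hi7 : i ≠ 7) :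
    ν (i + 1) + 2 ≤ ν (i - 1)! := by
  rcases Nat.even_or_odd' i with ⟨k, rfl | rfl⟩
  · rw [padicValNat_two_odd (by omega)]
    have := three_le_padicValNat_two_factorial (a := 2 * k - 1) (by omega)
    omega
  · rw [show 2 * k + 1 + 1 = 2 * (k + 1) by ring, padicValNat_two_double (by omega),
      show 2 * k + 1 - 1 = 2 * k by rfl, padicValNat_two_factorial_double]
    obtain rfl | hk : k = 2 ∨ 4 ≤ k := by omega
    · rw [padicValNat_two_odd (by omega)]
      simp
    · have := three_le_padicValNat_two_factorial hk
      have := padicValNat_two_lt (m := k + 1) (by omega)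
      omega

lemma padicValNat_two_fact_vals : ν 0 ! = 0 ∧ ν 1 ! = 0 ∧ ν 2 ! = 1 ∧ ν 3 ! = 1 ∧ ν 4 ! = 3 ∧
    ν 5 ! = 3 ∧ ν 6 ! = 4 ∧ ν 7 ! = 4 ∧ ν 8 ! = 7 ∧ ν 9 ! = 7 ∧ ν 10 ! = 8 := by
  have h0 : ν 0 ! = 0 := by simp
  have h1 : ν 1 ! = 0 := by simp
  have h2 : ν 2 ! = 1 := by simp
  have h4 := padicValNat_two_factorial_four
  have h (k : ℕ) : ν (2 * k + 1)! = ν (2 * k)! := by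
    rw [padicValNat_two_factorial_succ, padicValNat_two_odd (by omega), zero_add]
  have d := padicValNat_two_factorial_double
  have h3 := h 1
  have h5 := h 2
  have h6 := d 3
  have h7 := h 3
  have h8 := d 4
  have h9 := h 4
  have h10 := d 5
  simp only [Nat.reduceMul, Nat.reduceAdd] at h3 h5 h6 h7 h8 h9 h10
  omega

/-- Lower bound for the valuation of `((i + 1) m - 2)! / ((i + 1) ^ m m!)`. -/
lemma padicValNat_two_block_bound {i m : ℕ} (hi : 2 ≤ i) (hi3 : i ≠ 3) (hm : m ≠ 0)
    (h2 : ¬(i = 2 ∧ m = 1)) (h4 : ¬(i = 4 ∧ m = 1)) (h7 : ¬(i = 7 ∧ m = 1)) :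
    m * ν (i + 1) + ν m ! + 2 ≤ ν ((i + 1) * m - 2)! := by
  obtain ⟨v0, v1, v2, v3, v4, v5, v6, v7, v8, v9, v10⟩ := padicValNat_two_fact_vals
  obtain ⟨m, rfl⟩ := Nat.exists_eq_succ_of_ne_zero hm
  rcases Nat.eq_zero_or_pos m with rfl | hm0
  · have := padicValNat_two_succ_add_two_le (i := i) (by omega) (by omega)
    simpa using this
  have hlt := padicValNat_two_lt (m := m + 1) (by omega)
  have hs := padicValNat_two_factorial_succ m
  have hb := padicValNat_two_block_le i m
  have ha := padicValNat_two_factorial_add ((i + 1) * m) (i - 1)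
  rw [show (i + 1) * m + (i - 1) = (i + 1) * (m + 1) - 2 by rw [mul_add]; omega] at ha
  have hm1 : (m + 1) * ν (i + 1) = m * ν (i + 1) + ν (i + 1) := by ring
  rw [Nat.succ_eq_add_one, hm1]
  obtain rfl | rfl | rfl | ⟨h5, h7'⟩ : i = 2 ∨ i = 4 ∨ i = 7 ∨ (5 ≤ i ∧ i ≠ 7) := by omega
  · have e3 : ν (2 + 1) = 0 := padicValNat_two_odd (by omega)
    rw [e3] at hb ⊢
    simp only [Nat.reduceAdd, Nat.reduceSub, v1, v2] at ha hb ⊢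
    rcases Nat.lt_or_ge m 4 with hm4 | hm4
    · interval_cases m <;> simp only [Nat.reduceMul, Nat.reduceAdd, Nat.reduceSub] at * <;> omega
    · have := padicValNat_two_add_four_le (m := m + 1) (by omega)
      omega
  · have e3 : ν (4 + 1) = 0 := padicValNat_two_odd (by omega)
    rw [e3] at hb ⊢
    simp only [Nat.reduceAdd, Nat.reduceSub, v3, v4] at ha hb ⊢
    omega
  · have e3 : ν (7 + 1) = 3 := by
      rw [show 7 + 1 = 2 ^ 3 by rfl, padicValNat.prime_pow]
    rw [e3] at hb ⊢
    simp only [Nat.reduceAdd, Nat.reduceSub, v6, v7] at ha hb ⊢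
    omega
  · have := padicValNat_two_succ_add_two_le h5 h7'
    have h3 := three_le_padicValNat_two_factorial (a := i) (by omega)
    have : m * 3 ≤ m * ν i ! := Nat.mul_le_mul_left _ h3
    omega

lemma padicValNat_two_block_bound_weak {i m : ℕ} (hi : 2 ≤ i) (hi3 : i ≠ 3) (hm : m ≠ 0) :
    m * ν (i + 1) + ν m ! ≤ ν ((i + 1) * m - 2)! := by
  obtain ⟨-, v1, -, -, -, -, v6, -⟩ := padicValNat_two_fact_vals
  by_cases h2 : i = 2 ∧ m = 1
  · obtain ⟨rfl, rfl⟩ := h2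
    rw [padicValNat_two_odd (n := 2 + 1) (by omega)]
    simp
  by_cases h4 : i = 4 ∧ m = 1
  · obtain ⟨rfl, rfl⟩ := h4
    rw [padicValNat_two_odd (n := 4 + 1) (by omega)]
    simp
  by_cases h7 : i = 7 ∧ m = 1
  · obtain ⟨rfl, rfl⟩ := h7
    rw [show 7 + 1 = 2 ^ 3 by rfl, padicValNat.prime_pow]
    simp only [Nat.reducePow, Nat.reduceMul, Nat.reduceSub, v1, v6]
    omega
  have := padicValNat_two_block_bound hi hi3 hm h2 h4 h7
  omega

lemma gam_eq_mul_erase (u : ℕ →₀ ℕ) (i : ℕ) :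
    gam u = (i + 1) ^ u i * (u i)! * gam (u.erase i) :=
  (Finsupp.mul_prod_erase' u i (fun i m => (i + 1) ^ m * m !) (by simp)).symm

lemma wt_eq_add_erase (u : ℕ →₀ ℕ) (i : ℕ) : wt u = i * u i + wt (u.erase i) :=
  (Finsupp.add_sum_erase' u i (fun i m => i * m) (by simp)).symm

lemma deg_eq_add_erase (u : ℕ →₀ ℕ) (i : ℕ) : deg u = u i + deg (u.erase i) :=
  (Finsupp.add_sum_erase' u i (fun _ m => m) (by simp)).symm

lemma wt_add_deg_eq_erase (u : ℕ →₀ ℕ) (i : ℕ) :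
    wt u + deg u = (i + 1) * u i + (wt (u.erase i) + deg (u.erase i)) := by
  rw [wt_eq_add_erase u i, deg_eq_add_erase u i]
  ring

lemma gam_ne_zero (u : ℕ →₀ ℕ) : gam u ≠ 0 :=
  Finset.prod_ne_zero_iff.2 fun _ _ =>
    mul_ne_zero (pow_ne_zero _ (Nat.succ_ne_zero _)) (Nat.factorial_ne_zero _)

lemma padicValNat_two_gam_eq (u : ℕ →₀ ℕ) (i : ℕ) :
    ν (gam u) = u i * ν (i + 1) + ν (u i)! + ν (gam (u.erase i)) := by
  rw [gam_eq_mul_erase u i, padicValNat_two_mul _ (gam_ne_zero _), padicValNat_two_factor]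
  exact mul_ne_zero (pow_ne_zero _ i.succ_ne_zero) (Nat.factorial_ne_zero _)

lemma gam_zero : gam 0 = 1 := Finsupp.prod_zero_index

lemma gam_dvd_factorial (u : ℕ →₀ ℕ) : gam u ∣ (wt u + deg u)! := by
  induction h : u.support.card generalizing u with
  | zero =>
    rw [Finset.card_eq_zero, Finsupp.support_eq_empty] at h
    subst h
    simp [gam_zero]
  | succ k ih =>
    obtain ⟨i, hi⟩ : u.support.Nonempty := Finset.card_pos.1 (by omega)
    have hd := ih (u.erase i) (by rw [Finsupp.support_erase, Finset.card_erase_of_mem hi]; omega)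
    rw [gam_eq_mul_erase u i, wt_add_deg_eq_erase u i]
    refine (mul_dvd_mul ?_ hd).trans (Nat.factorial_mul_factorial_dvd_factorial_add _ _)
    refine dvd_trans (mul_dvd_mul_right (pow_dvd_pow_of_dvd ?_ _) _)
      (pow_factorial_mul_factorial_dvd i (u i))
    exact Nat.dvd_factorial (Nat.succ_pos _) le_rfl

lemma padicValNat_two_gam_le (u : ℕ →₀ ℕ) : ν (gam u) ≤ ν (wt u + deg u)! :=
  padicValNat_two_mono (Nat.factorial_ne_zero _) (gam_dvd_factorial u)

lemma padicValNat_two_gam_add_three_le {u : ℕ →₀ ℕ} {j : ℕ} (hj : 4 ≤ j) (huj : u j ≠ 0) :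
    ν (gam u) + 3 ≤ ν (wt u + deg u)! := by
  rw [padicValNat_two_gam_eq u j, wt_add_deg_eq_erase u j]
  have h1 := padicValNat_two_factorial_add ((j + 1) * u j)
    (wt (u.erase j) + deg (u.erase j))
  have h2 := padicValNat_two_block_le j (u j)
  have h3 := padicValNat_two_gam_le (u.erase j)
  have h4 : 1 * 3 ≤ u j * ν j ! :=
    Nat.mul_le_mul (Nat.pos_of_ne_zero huj) (three_le_padicValNat_two_factorial hj)
  omega

/-- For a partition without parts equal to `1` or `3`, the coefficient `τ` is divisible by `4`
with three exceptions. -/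
lemma padicValNat_two_gam_add_two_le_of_no_one_three {r : ℕ →₀ ℕ} (h0 : r 0 = 0) (h1 : r 1 = 0)
    (h3 : r 3 = 0) (hr : r ≠ 0) (hr2 : r ≠ single 2 1) (hr4 : r ≠ single 4 1)
    (hr7 : r ≠ single 7 1) : ν (gam r) + 2 ≤ ν (wt r + deg r - 2)! := by
  have part_bound {i : ℕ} (hi : r i ≠ 0) : 2 ≤ i ∧ i ≠ 3 := by
    refine ⟨?_, fun h => hi (h ▸ h3)⟩
    by_contra! h
    interval_cases i <;> contradiction
  have key {i j : ℕ} (hij : j ≠ i) (hi : r i ≠ 0) (hj : r j ≠ 0) (h4 : 4 ≤ j) :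
      ν (gam r) + 2 ≤ ν (wt r + deg r - 2)! := by
    rw [padicValNat_two_gam_eq r i, wt_add_deg_eq_erase r i]
    have hle : 3 * 1 ≤ (i + 1) * r i :=
      Nat.mul_le_mul (by have := (part_bound hi).1; omega) (Nat.pos_of_ne_zero hi)
    rw [Nat.sub_add_comm (by omega)]
    have e1 := padicValNat_two_factorial_add ((i + 1) * r i - 2)
      (wt (r.erase i) + deg (r.erase i))
    have e2 := padicValNat_two_block_bound_weak (part_bound hi).1 (part_bound hi).2 hi
    have e3 := padicValNat_two_gam_add_three_le (u := r.erase i) h4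
      (by rwa [Finsupp.erase_ne hij])
    omega
  obtain ⟨i, hi⟩ := Finsupp.ne_iff.1 hr
  rw [Finsupp.zero_apply] at hi
  by_cases he : r.erase i = 0
  · have hs : r = single i (r i) := by
      rw [← Finsupp.single_add_erase i r, he]; simp
    rw [padicValNat_two_gam_eq r i, wt_add_deg_eq_erase r i, he, gam_zero]
    have := padicValNat_two_block_bound (part_bound hi).1 (part_bound hi).2 hi
      (by rintro ⟨h, h'⟩; rw [h', h] at hs; exact hr2 hs)
      (by rintro ⟨h, h'⟩; rw [h', h] at hs; exact hr4 hs)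
      (by rintro ⟨h, h'⟩; rw [h', h] at hs; exact hr7 hs)
    simpa [wt, deg] using this
  · obtain ⟨j, hj⟩ := Finsupp.ne_iff.1 he
    rw [Finsupp.zero_apply] at hj
    have hij : j ≠ i := by
      rintro rfl
      exact hj Finsupp.erase_same
    rw [Finsupp.erase_ne hij] at hj
    have := part_bound hi
    have := part_bound hj
    rcases Nat.lt_or_ge j 4 with h | h
    · exact key hij.symm hj hi (by omega)
    · exact key hij hi hj h

lemma gam_single (i m : ℕ) : gam (single i m) = (i + 1) ^ m * m ! :=
  Finsupp.prod_single_index (by simp)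

/-- The partition with `a` ones, `b` threes, `c` twos and `d` fours. -/
def shape (a b c d : ℕ) : ℕ →₀ ℕ := single 1 a + single 3 b + single 2 c + single 4 d

lemma padicValNat_two_four : ν 4 = 2 := by
  rw [show 4 = 2 ^ 2 by rfl, padicValNat.prime_pow]

lemma five_le_padicValNat_two_add {a : ℕ} (h : a % 4 = 2) : 5 ≤ ν (a + 2) + ν (a + 6) := by
  rw [← padicValNat_two_mul (by omega) (by omega)]
  refine le_padicValNat_two (by positivity) ?_
  obtain ⟨k, rfl⟩ : ∃ k, a = 4 * k + 2 := ⟨a / 4, by omega⟩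
  obtain ⟨l, hl⟩ := Nat.even_mul_succ_self (k + 1)
  refine ⟨l, ?_⟩
  calc (4 * k + 2 + 2) * (4 * k + 2 + 6) = 16 * ((k + 1) * (k + 1 + 1)) := by ring
    _ = _ := by rw [hl]; ring

lemma padicValNat_two_one_three_block {a b : ℕ} (hab : (a + 3 * b) % 4 = 2) (hb : 3 ≤ b) :
    a + ν a ! + (2 * b + ν b !) + 2 ≤ ν (2 * a + 4 * b - 2)! := by
  have hd := padicValNat_two_factorial_double
  have hs := padicValNat_two_factorial_succ
  obtain ⟨-, -, -, v3, v4, -⟩ := padicValNat_two_fact_vals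
  obtain rfl | rfl | h5 : b = 3 ∨ b = 4 ∨ 5 ≤ b := by omega
  · rw [show 2 * a + 4 * 3 - 2 = 2 * (a + 5) by omega, hd, hs (a + 4), hs (a + 3),
      hs (a + 2), hs (a + 1), hs a, v3]
    have h1 : 1 ≤ ν (a + 1) := le_padicValNat_two (by omega) (by omega)
    have h3 : 2 ≤ ν (a + 3) := le_padicValNat_two (by omega) (by omega)
    have h5 : 1 ≤ ν (a + 5) := le_padicValNat_two (by omega) (by omega)
    simp only [add_assoc, Nat.reduceAdd] at *
    omega
  · rw [show 2 * a + 4 * 4 - 2 = 2 * (a + 7) by omega, hd, hs (a + 6), hs (a + 5),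
      hs (a + 4), hs (a + 3), hs (a + 2), hs (a + 1), hs a, v4]
    have h4 : 1 ≤ ν (a + 4) := le_padicValNat_two (by omega) (by omega)
    have h26 := five_le_padicValNat_two_add (a := a) (by omega)
    simp only [add_assoc, Nat.reduceAdd] at *
    omega
  · obtain ⟨b, rfl⟩ : ∃ k, b = k + 1 := ⟨b - 1, by omega⟩
    have hadd := padicValNat_two_factorial_add (2 * a) (4 * (b + 1) - 2)
    have h1 := hd (2 * b + 1)
    have h2 := hs (2 * b)
    have h3 := hd b
    have h4 := hs b
    have h6 := padicValNat_two_add_four_le h5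
    rw [show 4 * (b + 1) - 2 = 2 * (2 * b + 1) by omega] at hadd
    rw [show 2 * a + 4 * (b + 1) - 2 = 2 * a + 2 * (2 * b + 1) by omega]
    have h7 := hd a
    rw [padicValNat_two_odd (n := 2 * b + 1) (by omega)] at h2
    omega

lemma shape_or_padicValNat_two_gam_add_two_le {n : ℕ} (hmod : n % 4 = 2) {u : ℕ →₀ ℕ}
    (h0 : u 0 = 0) (hw : wt u = n) :
    (u = shape n 0 0 0 ∨ u = shape (n - 3) 1 0 0 ∨ u = shape (n - 6) 2 0 0 ∨
      u = shape (n - 2) 0 1 0 ∨ u = shape (n - 5) 1 1 0 ∨ u = shape (n - 4) 0 0 1) ∨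
    ν (gam u) + 2 ≤ ν (wt u + deg u - 2)! := by
  refine or_iff_not_imp_left.2 fun hu => ?_
  rw [not_or, not_or, not_or, not_or, not_or] at hu
  obtain ⟨hu1, hu2, hu3, hu4, hu5, hu6⟩ := hu
  have e3 : (u.erase 1) 3 = u 3 := Finsupp.erase_ne (by omega)
  have hS : wt u + deg u = 2 * u 1 + (4 * u 3 +
      (wt ((u.erase 1).erase 3) + deg ((u.erase 1).erase 3))) := by
    rw [wt_add_deg_eq_erase u 1, wt_add_deg_eq_erase (u.erase 1) 3, e3]
  have hW : n = u 1 + 3 * u 3 + wt ((u.erase 1).erase 3) := by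
    rw [← hw, wt_eq_add_erase u 1, wt_eq_add_erase (u.erase 1) 3, e3]
    ring
  have hG : ν (gam u) = u 1 + ν (u 1)! + (2 * u 3 + ν (u 3)! +
      ν (gam ((u.erase 1).erase 3))) := by
    rw [padicValNat_two_gam_eq u 1, padicValNat_two_gam_eq (u.erase 1) 3, e3,
      padicValNat_self, padicValNat_two_four, mul_one, mul_comm (u 3)]
  have hdec : u = single 1 (u 1) + single 3 (u 3) + (u.erase 1).erase 3 := by
    rw [add_assoc, ← e3, Finsupp.single_add_erase, Finsupp.single_add_erase]
  have r0 : ((u.erase 1).erase 3) 0 = 0 := by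
    rw [Finsupp.erase_ne (by omega), Finsupp.erase_ne (by omega), h0]
  have r1 : ((u.erase 1).erase 3) 1 = 0 := by
    rw [Finsupp.erase_ne (by omega), Finsupp.erase_same]
  have r3 : ((u.erase 1).erase 3) 3 = 0 := Finsupp.erase_same
  generalize (u.erase 1).erase 3 = r at *
  generalize u 1 = a at *
  generalize u 3 = b at *
  rw [hG, hS]
  have ha := padicValNat_two_factorial_double a
  have hb : ν (4 * b)! = 2 * b + b + ν b ! := by
    rw [show 4 * b = 2 * (2 * b) by ring, padicValNat_two_factorial_double,
      padicValNat_two_factorial_double, add_assoc]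
  by_cases hr : r = 0
  · subst hr
    have hwt0 : wt 0 = 0 := Finsupp.sum_zero_index
    have hdeg0 : deg 0 = 0 := Finsupp.sum_zero_index
    rw [hwt0] at hW
    rw [hwt0, hdeg0, gam_zero, padicValNat_one_right]
    rcases Nat.lt_or_ge b 3 with h | h
    · exfalso
      interval_cases b
      · exact hu1 (by rw [hdec, hW]; simp [shape])
      · exact hu2 (by rw [hdec, hW]; simp [shape])
      · exact hu3 (by rw [hdec, hW]; simp [shape])
    · exact padicValNat_two_one_three_block (by omega) h
  have hadd1 := padicValNat_two_factorial_add (2 * a) (4 * b)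
  have hadd2 := padicValNat_two_factorial_add (2 * a + 4 * b) (wt r + deg r - 2)
  by_cases hr2 : r = single 2 1
  · subst hr2
    have hw2 : wt (single 2 1) = 2 := by simp [wt]
    have hd2 : deg (single 2 1) = 1 := by simp [deg]
    have hg2 : ν (gam (single 2 1)) = 0 := by
      rw [show gam (single 2 1) = 3 by simp [gam_single]]
      exact padicValNat_two_odd (by omega)
    rw [hw2] at hW
    rw [hw2, hd2] at hadd2 ⊢
    rw [show 2 * a + (4 * b + (2 + 1)) - 2 = 2 * a + 4 * b + (2 + 1 - 2) by omega]
    rcases Nat.lt_or_ge b 2 with h | h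
    · exfalso
      interval_cases b
      · exact hu4 (by rw [hdec, hW]; simp [shape])
      · exact hu5 (by rw [hdec, hW]; simp [shape])
    · omega
  by_cases hr4 : r = single 4 1
  · subst hr4
    have hw4 : wt (single 4 1) = 4 := by simp [wt]
    have hd4 : deg (single 4 1) = 1 := by simp [deg]
    have hg4 : ν (gam (single 4 1)) = 0 := by
      rw [show gam (single 4 1) = 5 by simp [gam_single]]
      exact padicValNat_two_odd (by omega)
    obtain ⟨-, -, -, v3, -⟩ := padicValNat_two_fact_vals
    rw [hw4] at hW
    rw [hw4, hd4] at hadd2 ⊢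
    simp only [Nat.reduceAdd, Nat.reduceSub, v3] at hadd2
    rw [show 2 * a + (4 * b + (4 + 1)) - 2 = 2 * a + 4 * b + 3 by omega]
    rcases Nat.eq_zero_or_pos b with rfl | h
    · exact absurd (by rw [hdec, hW]; simp [shape]) hu6
    · omega
  by_cases hr7 : r = single 7 1
  · subst hr7
    have hw7 : wt (single 7 1) = 7 := by simp [wt]
    have hd7 : deg (single 7 1) = 1 := by simp [deg]
    have hg7 : ν (gam (single 7 1)) = 3 := by
      rw [show gam (single 7 1) = 2 ^ 3 by simp [gam_single], padicValNat.prime_pow]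
    obtain ⟨-, -, -, -, -, -, v6, -⟩ := padicValNat_two_fact_vals
    rw [hw7] at hW
    rw [hw7, hd7] at hadd2 ⊢
    simp only [Nat.reduceAdd, Nat.reduceSub, v6] at hadd2
    rw [show 2 * a + (4 * b + (7 + 1)) - 2 = 2 * a + 4 * b + 6 by omega]
    rcases Nat.eq_zero_or_pos b with rfl | h
    · rw [show 2 * a + 4 * 0 + 6 = 2 * (a + 3) by ring, padicValNat_two_factorial_double,
        padicValNat_two_factorial_succ, padicValNat_two_factorial_succ,
        padicValNat_two_factorial_succ]
      have h4 : 2 ≤ ν (a + 1) := le_padicValNat_two (by omega) (by omega)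
      simp only [add_assoc, Nat.reduceAdd, Nat.factorial_zero, padicValNat_one_right, hg7] at *
      omega
    · omega
  have hmain := padicValNat_two_gam_add_two_le_of_no_one_three r0 r1 r3 hr hr2 hr4 hr7
  have hge : 2 ≤ wt r + deg r := by
    obtain ⟨i, hi⟩ := Finsupp.ne_iff.1 hr
    rw [Finsupp.zero_apply] at hi
    rw [wt_add_deg_eq_erase r i]
    have hi0 : i ≠ 0 := by
      rintro rfl
      exact hi r0
    have : 2 * 1 ≤ (i + 1) * r i := Nat.mul_le_mul (by omega) (Nat.pos_of_ne_zero hi)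
    omega
  rw [show 2 * a + (4 * b + (wt r + deg r)) - 2 = 2 * a + 4 * b + (wt r + deg r - 2) by omega]
  omega

lemma shape_apply (a b c d : ℕ) : shape a b c d 2 = c ∧ shape a b c d 3 = b ∧
    shape a b c d 4 = d := by
  simp [shape]

lemma sum_shape {M : Type*} [AddCommMonoid M] (f : ℕ → ℕ → M) (hf : ∀ i, f i 0 = 0)
    (a b c d : ℕ) : (shape a b c d).sum f = f 1 a + f 3 b + f 2 c + f 4 d := by
  have hs : (shape a b c d).support ⊆ {1, 3, 2, 4} := by
    intro i hi
    contrapose! hi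
    simp only [Finset.mem_insert, Finset.mem_singleton, not_or] at hi
    simp [shape, hi.1, hi.2.1, hi.2.2.1, hi.2.2.2]
  rw [Finsupp.sum_of_support_subset _ hs _ (fun i _ => hf i)]
  simp [shape, add_assoc]

lemma wt_shape (a b c d : ℕ) : wt (shape a b c d) = a + 3 * b + 2 * c + 4 * d := by
  rw [wt, sum_shape _ (by simp), one_mul]

lemma deg_shape (a b c d : ℕ) : deg (shape a b c d) = a + b + c + d := by
  rw [deg, sum_shape _ (by simp)]

lemma gam_shape (a b c d : ℕ) : gam (shape a b c d) =
    2 ^ a * a ! * (4 ^ b * b !) * (3 ^ c * c !) * (5 ^ d * d !) := by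
  have := sum_shape (M := Additive ℕ) (fun i m => Additive.ofMul ((i + 1) ^ m * m !)) (by simp)
    a b c d
  exact this

lemma tau_shape {a b c d s N : ℕ} (hs : a + b + c + d - 1 = s)
    (hN : 2 * a + 4 * b + 3 * c + 5 * d - 2 = N) : tau (shape a b c d) =
    (-1) ^ s * (N ! : ℚ) / (2 ^ a * a ! * (4 ^ b * b !) * (3 ^ c * c !) * (5 ^ d * d !)) := by
  rw [tau, gam_shape, wt_shape, deg_shape, hs, show a + 3 * b + 2 * c + 4 * d + (a + b + c + d) - 2
    = N by omega]
  push_cast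
  rfl

lemma factorial_two_mul_add_one (m : ℕ) : (2 * m + 1)! = (2 * m + 1)‼ * (2 ^ m * m !) := by
  rw [Nat.factorial_eq_mul_doubleFactorial, Nat.doubleFactorial_two_mul]

lemma factorial_two_mul_add_two (m : ℕ) :
    (2 * m + 2)! = (2 * m + 1)‼ * (2 ^ (m + 1) * (m + 1)!) := by
  rw [Nat.factorial_eq_mul_doubleFactorial, ← Nat.doubleFactorial_two_mul, mul_comm]
  rfl

lemma doubleFactorial_eight_mul_add_nine (k : ℕ) : ∃ e, (8 * k + 9)‼ = 16 * e + 1 := by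
  induction k with
  | zero => exact ⟨59, by decide⟩
  | succ k ih =>
    obtain ⟨e, he⟩ := ih
    refine ⟨(256 * k ^ 4 + 1792 * k ^ 3 + 4664 * k ^ 2 + 5348 * k + 2279) * (16 * e + 1) + e, ?_⟩
    rw [show 8 * (k + 1) + 9 = 8 * k + 9 + 2 + 2 + 2 + 2 by ring]
    rw [Nat.doubleFactorial_add_two, Nat.doubleFactorial_add_two, Nat.doubleFactorial_add_two,
      Nat.doubleFactorial_add_two, he]
    ring

lemma doubleFactorial_eight_mul_add_five (k : ℕ) : ∃ e, (8 * k + 5)‼ = 8 * e + 7 := by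
  induction k with
  | zero => exact ⟨1, by decide⟩
  | succ k ih =>
    obtain ⟨e, he⟩ := ih
    refine ⟨(512 * k ^ 4 + 2560 * k ^ 3 + 4720 * k ^ 2 + 3800 * k + 1126) * (8 * e + 7) + e, ?_⟩
    rw [show 8 * (k + 1) + 5 = 8 * k + 5 + 2 + 2 + 2 + 2 by ring]
    rw [Nat.doubleFactorial_add_two, Nat.doubleFactorial_add_two, Nat.doubleFactorial_add_two,
      Nat.doubleFactorial_add_two, he]
    ring

lemma doubleFactorial_eight_mul_add_seven (k : ℕ) : ∃ e, (8 * k + 7)‼ = 2 * e + 1 := by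
  obtain ⟨e, he⟩ := doubleFactorial_eight_mul_add_five k
  refine ⟨(8 * k + 7) * (4 * e + 3) + (4 * k + 3), ?_⟩
  rw [show 8 * k + 7 = 8 * k + 5 + 2 by ring, Nat.doubleFactorial_add_two, he]
  ring

lemma le_pval_two_of_mul_eq {q : ℚ} (o : ℕ) (z : ℤ) (ho : o % 2 = 1) (h : q * o = 4 * z) :
    (((2 : ℕ) : ℤ) : WithTop ℤ) ≤ pval 2 q := by
  rw [pval]
  split_ifs with hq
  · exact le_top
  have ho0 : (o : ℚ) ≠ 0 := by
    rw [Nat.cast_ne_zero]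
    omega
  have hz : (z : ℚ) ≠ 0 := by
    rintro hz
    rw [hz, mul_zero] at h
    exact mul_ne_zero hq ho0 h
  have hv := congrArg (padicValRat 2) h
  rw [padicValRat.mul hq ho0, padicValRat.mul (by norm_num) hz, padicValRat.of_nat,
    padicValNat_two_odd ho, padicValRat.of_int, show (4 : ℚ) = ((2 ^ 2 : ℕ) : ℚ) by norm_num,
    padicValRat.of_nat, padicValNat.prime_pow] at hv
  rw [WithTop.coe_le_coe]
  push_cast at hv ⊢
  omega

lemma le_pval_two_tau {u : ℕ →₀ ℕ} (h : ν (gam u) + 2 ≤ ν (wt u + deg u - 2)!) :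
    (((2 : ℕ) : ℤ) : WithTop ℤ) ≤ pval 2 (tau u) := by
  have hg := gam_ne_zero u
  obtain ⟨o, ho⟩ : 2 ^ ν (gam u) ∣ gam u := pow_padicValNat_dvd
  obtain ⟨w, hw⟩ : 2 ^ (ν (gam u) + 2) ∣ (wt u + deg u - 2)! :=
    (padicValNat_dvd_iff_le (Nat.factorial_ne_zero _)).2 h
  have ho2 : o % 2 = 1 := by
    by_contra hc
    obtain ⟨o', rfl⟩ : 2 ∣ o := by omega
    refine pow_succ_padicValNat_not_dvd (p := 2) hg ⟨o', ?_⟩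
    rw [pow_succ, mul_assoc]
    exact ho
  have ho0 : (o : ℚ) ≠ 0 := by
    rw [Nat.cast_ne_zero]
    omega
  refine le_pval_two_of_mul_eq o ((-1) ^ (deg u - 1) * w) ho2 ?_
  have hgQ : (gam u : ℚ) = 2 ^ ν (gam u) * o := by
    exact_mod_cast ho
  have hwQ : ((wt u + deg u - 2)! : ℚ) = 2 ^ (ν (gam u) + 2) * w := by
    exact_mod_cast hw
  rw [tau, hwQ, hgQ]
  push_cast
  field_simp
  ring

lemma tau_shape_one (k : ℕ) : tau (shape (4 * k + 6) 0 0 0) =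
    -((8 * k + 9)‼ : ℚ) / (4 * (2 * k + 3)) := by
  rw [tau_shape (s := 2 * (2 * k + 2) + 1) (N := 2 * (4 * k + 4) + 2) (by omega) (by omega),
    factorial_two_mul_add_two, show 4 * k + 6 = 4 * k + 4 + 1 + 1 by ring,
    Nat.factorial_succ (4 * k + 4 + 1), show 2 * (4 * k + 4) + 1 = 8 * k + 9 by ring]
  rw [pow_succ (-1 : ℚ), pow_mul]
  have := Nat.cast_ne_zero (R := ℚ).2 (Nat.factorial_ne_zero (4 * k + 4 + 1))
  have h3 : (2 * k + 3 : ℚ) ≠ 0 := by positivity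
  have h4 : (4 * k + 6 : ℚ) ≠ 0 := by positivity
  push_cast
  field_simp
  simp
  ring

lemma tau_shape_three (k : ℕ) : tau (shape (4 * k + 3) 1 0 0) =
    -((8 * k + 7)‼ : ℚ) * (2 * k + 2) := by
  rw [tau_shape (s := 2 * (2 * k + 1) + 1) (N := 2 * (4 * k + 3) + 2) (by omega) (by omega),
    factorial_two_mul_add_two, Nat.factorial_succ (4 * k + 3),
    show 2 * (4 * k + 3) + 1 = 8 * k + 7 by ring]
  rw [pow_succ (-1 : ℚ), pow_mul]
  have := Nat.cast_ne_zero (R := ℚ).2 (Nat.factorial_ne_zero (4 * k + 3))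
  push_cast
  field_simp
  simp
  ring

lemma tau_shape_three_three (k : ℕ) : tau (shape (4 * k) 2 0 0) =
    -((8 * k + 5)‼ : ℚ) * ((4 * k + 3) * (2 * k + 1) * (4 * k + 1)) / 2 := by
  rw [tau_shape (s := 2 * (2 * k) + 1) (N := 2 * (4 * k + 2) + 2) (by omega) (by omega),
    factorial_two_mul_add_two, Nat.factorial_succ (4 * k + 2), Nat.factorial_succ (4 * k + 1),
    Nat.factorial_succ (4 * k), show 2 * (4 * k + 2) + 1 = 8 * k + 5 by ring]
  rw [pow_succ (-1 : ℚ), pow_mul]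
  have := Nat.cast_ne_zero (R := ℚ).2 (Nat.factorial_ne_zero (4 * k))
  push_cast
  field_simp
  simp
  ring

lemma tau_shape_two (k : ℕ) : tau (shape (4 * k + 4) 0 1 0) = ((8 * k + 9)‼ : ℚ) / 3 := by
  rw [tau_shape (s := 2 * (2 * k + 2)) (N := 2 * (4 * k + 4) + 1) (by omega) (by omega),
    factorial_two_mul_add_one, show 2 * (4 * k + 4) + 1 = 8 * k + 9 by ring]
  rw [pow_mul]
  have := Nat.cast_ne_zero (R := ℚ).2 (Nat.factorial_ne_zero (4 * k + 4))
  push_cast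
  field_simp
  simp

lemma tau_shape_two_three (k : ℕ) : tau (shape (4 * k + 1) 1 1 0) =
    ((8 * k + 7)‼ : ℚ) * ((4 * k + 3) * (4 * k + 2)) / 3 := by
  rw [tau_shape (s := 2 * (2 * k + 1)) (N := 2 * (4 * k + 3) + 1) (by omega) (by omega),
    factorial_two_mul_add_one, Nat.factorial_succ (4 * k + 2), Nat.factorial_succ (4 * k + 1),
    show 2 * (4 * k + 3) + 1 = 8 * k + 7 by ring]
  rw [pow_mul]
  have := Nat.cast_ne_zero (R := ℚ).2 (Nat.factorial_ne_zero (4 * k + 1))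
  push_cast
  field_simp
  simp
  ring

lemma tau_shape_four (k : ℕ) : tau (shape (4 * k + 2) 0 0 1) =
    2 * ((8 * k + 7)‼ : ℚ) * (4 * k + 3) / 5 := by
  rw [tau_shape (s := 2 * (2 * k + 1)) (N := 2 * (4 * k + 3) + 1) (by omega) (by omega),
    factorial_two_mul_add_one, Nat.factorial_succ (4 * k + 2),
    show 2 * (4 * k + 3) + 1 = 8 * k + 7 by ring]
  rw [pow_mul]
  have := Nat.cast_ne_zero (R := ℚ).2 (Nat.factorial_ne_zero (4 * k + 2))
  push_cast
  field_simp
  simp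
  ring

lemma wt_toFinsupp (s : Multiset ℕ) : wt (Multiset.toFinsupp s) = s.sum := by
  rw [Finset.sum_multiset_count]
  simp [wt, Finsupp.sum, mul_comm]

lemma coeff_divB (n : ℕ) (u : ℕ →₀ ℕ) :
    coeff u (divB n) = if u 0 = 0 ∧ wt u = n then tau u else 0 := by
  rw [divB, coeff_sum]
  simp only [coeff_smul, coeff_monomial, smul_eq_mul, mul_ite, mul_one, mul_zero]
  split_ifs with h
  · obtain ⟨h0, hw⟩ := h
    have hu : Multiset.toFinsupp (Finsupp.toMultiset u) = u := Finsupp.toMultiset_toFinsupp u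
    let P : n.Partition := ⟨Finsupp.toMultiset u, fun {i} hi => by
      rw [Finsupp.mem_toMultiset, Finsupp.mem_support_iff] at hi
      exact Nat.pos_of_ne_zero fun h => hi (h ▸ h0), by
      rw [← wt_toFinsupp, hu, hw]⟩
    rw [Finset.sum_eq_single P]
    · rw [if_pos hu, hu]
    · intro Q _ hQ
      refine if_neg fun h => hQ (Nat.Partition.ext ?_)
      exact Multiset.toFinsupp.injective (h.trans hu.symm)
    · exact fun h => absurd (Finset.mem_univ P) h
  · refine Finset.sum_eq_zero fun Q _ => if_neg fun hQ => h ?_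
    subst hQ
    refine ⟨?_, by rw [wt_toFinsupp, Q.parts_sum]⟩
    rw [Multiset.toFinsupp_apply, Multiset.count_eq_zero]
    exact fun h => (Q.parts_pos h).ne' rfl

lemma monomial_shape (a b c d : ℕ) (x : ℚ) :
    monomial (shape a b c d) x = C x * X 1 ^ a * X 3 ^ b * X 2 ^ c * X 4 ^ d := by
  simp only [X_pow_eq_monomial, C_mul_monomial, monomial_mul, shape, mul_one]

lemma shape_inj {a b c d a' b' c' d' : ℕ} (h : shape a b c d = shape a' b' c' d') :
    b = b' ∧ c = c' ∧ d = d' := by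
  obtain ⟨h2, h3, h4⟩ := shape_apply a b c d
  obtain ⟨h2', h3', h4'⟩ := shape_apply a' b' c' d'
  exact ⟨by rw [← h3, ← h3', h], by rw [← h2, ← h2', h], by rw [← h4, ← h4', h]⟩

lemma shape_apply_zero (a b c d : ℕ) : shape a b c d 0 = 0 := by
  simp [shape]

/-- for n ≡ 2 (mod 4), n ≥ 6, the congruence mod 4 = 2^2 for B̂_n/n. -/
theorem stmt_15 (n : ℕ) (hn : 6 ≤ n) (hmod : n % 4 = 2) :
    PCong 2 2 (divB n)
      (C (-(1 : ℚ) / (2 * (n : ℚ))) * X 1 ^ n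
        + C ((n : ℚ) / 2 - 1) * X 1 ^ (n - 3) * X 3
        + C (3 * ((n : ℚ) - 4) / 4) * X 1 ^ (n - 6) * X 3 ^ 2
        - X 1 ^ (n - 2) * X 2
        + C (2 : ℚ) * X 1 ^ (n - 5) * (X 2 * X 3 + X 1 * X 4)) := by
  obtain ⟨k, rfl⟩ : ∃ k, n = 4 * k + 6 := ⟨(n - 6) / 4, by omega⟩
  intro u
  have hclass := fun h0 hw => shape_or_padicValNat_two_gam_add_two_le hmod (u := u) h0 hw
  simp only [Nat.reduceSubDiff, Nat.add_sub_cancel] at hclass ⊢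
  rw [show C (-(1 : ℚ) / (2 * ((4 * k + 6 : ℕ) : ℚ))) * X 1 ^ (4 * k + 6)
        + C (((4 * k + 6 : ℕ) : ℚ) / 2 - 1) * X 1 ^ (4 * k + 3) * X 3
        + C (3 * (((4 * k + 6 : ℕ) : ℚ) - 4) / 4) * X 1 ^ (4 * k) * X 3 ^ 2
        - X 1 ^ (4 * k + 4) * X 2
        + C (2 : ℚ) * X 1 ^ (4 * k + 1) * (X 2 * X 3 + X 1 * X 4) =
      monomial (shape (4 * k + 6) 0 0 0) (-(1 : ℚ) / (4 * (2 * k + 3)))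
        + monomial (shape (4 * k + 3) 1 0 0) (2 * k + 2 : ℚ)
        + monomial (shape (4 * k) 2 0 0) (3 * (2 * k + 1) / 2 : ℚ)
        + monomial (shape (4 * k + 4) 0 1 0) (-1 : ℚ)
        + monomial (shape (4 * k + 1) 1 1 0) (2 : ℚ)
        + monomial (shape (4 * k + 2) 0 0 1) (2 : ℚ) by
    simp only [monomial_shape]
    rw [show -(1 : ℚ) / (2 * ((4 * k + 6 : ℕ) : ℚ)) = -(1 : ℚ) / (4 * (2 * k + 3)) by
        push_cast; congr 1; ring,
      show ((4 * k + 6 : ℕ) : ℚ) / 2 - 1 = 2 * k + 2 by push_cast; ring,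
      show 3 * (((4 * k + 6 : ℕ) : ℚ) - 4) / 4 = 3 * (2 * k + 1) / 2 by push_cast; ring,
      show C (-1 : ℚ) = (-1 : MvPolynomial ℕ ℚ) by simp]
    ring]
  rw [coeff_sub, coeff_divB]
  simp only [coeff_add, coeff_monomial]
  by_cases hu : u 0 = 0 ∧ wt u = 4 * k + 6
  swap
  · have hne (a b c d : ℕ) (h : a + 3 * b + 2 * c + 4 * d = 4 * k + 6) : shape a b c d ≠ u :=
      fun hs => hu (by rw [← hs, wt_shape]; exact ⟨shape_apply_zero _ _ _ _, h⟩)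
    rw [if_neg hu, if_neg (hne _ _ _ _ (by omega)), if_neg (hne _ _ _ _ (by omega)),
      if_neg (hne _ _ _ _ (by omega)), if_neg (hne _ _ _ _ (by omega)),
      if_neg (hne _ _ _ _ (by omega)), if_neg (hne _ _ _ _ (by omega))]
    simp [pval]
  rw [if_pos hu]
  have hne {a b c d a' b' c' d' : ℕ} (h : ¬(b = b' ∧ c = c' ∧ d = d')) :
      shape a b c d ≠ shape a' b' c' d' := fun hs => h (shape_inj hs)
  obtain ⟨x, hx⟩ := doubleFactorial_eight_mul_add_nine k
  obtain ⟨y, hy⟩ := doubleFactorial_eight_mul_add_seven k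
  obtain ⟨z, hz⟩ := doubleFactorial_eight_mul_add_five k
  by_cases hs : u = shape (4 * k + 6) 0 0 0 ∨ u = shape (4 * k + 3) 1 0 0 ∨
      u = shape (4 * k) 2 0 0 ∨ u = shape (4 * k + 4) 0 1 0 ∨ u = shape (4 * k + 1) 1 1 0 ∨
      u = shape (4 * k + 2) 0 0 1
  · rcases hs with rfl | rfl | rfl | rfl | rfl | rfl
    · rw [if_pos rfl, if_neg (hne (by omega)), if_neg (hne (by omega)), if_neg (hne (by omega)),
        if_neg (hne (by omega)), if_neg (hne (by omega)), tau_shape_one, hx]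
      refine le_pval_two_of_mul_eq (2 * k + 3) (-x) (by omega) ?_
      have : (2 * k + 3 : ℚ) ≠ 0 := by positivity
      push_cast
      field_simp
      ring
    · rw [if_pos rfl, if_neg (hne (by omega)), if_neg (hne (by omega)), if_neg (hne (by omega)),
        if_neg (hne (by omega)), if_neg (hne (by omega)), tau_shape_three, hy]
      refine le_pval_two_of_mul_eq 1 (-(k + 1) * (y + 1)) (by omega) ?_
      push_cast
      ring
    · rw [if_pos rfl, if_neg (hne (by omega)), if_neg (hne (by omega)), if_neg (hne (by omega)),
        if_neg (hne (by omega)), if_neg (hne (by omega)), tau_shape_three_three, hz]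
      refine le_pval_two_of_mul_eq 1
        (-(2 * k + 1) * (z * (4 * k + 3) * (4 * k + 1) + 14 * k ^ 2 + 14 * k + 3)) (by omega) ?_
      push_cast
      ring
    · rw [if_pos rfl, if_neg (hne (by omega)), if_neg (hne (by omega)), if_neg (hne (by omega)),
        if_neg (hne (by omega)), if_neg (hne (by omega)), tau_shape_two, hx]
      refine le_pval_two_of_mul_eq 3 (4 * x + 1) (by omega) ?_
      push_cast
      ring
    · rw [if_pos rfl, if_neg (hne (by omega)), if_neg (hne (by omega)), if_neg (hne (by omega)),
        if_neg (hne (by omega)), if_neg (hne (by omega)), tau_shape_two_three, hy]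
      refine le_pval_two_of_mul_eq 3
        (y * (4 * k + 3) * (2 * k + 1) + (4 * k ^ 2 + 5 * k)) (by omega) ?_
      push_cast
      ring
    · rw [if_pos rfl, if_neg (hne (by omega)), if_neg (hne (by omega)), if_neg (hne (by omega)),
        if_neg (hne (by omega)), if_neg (hne (by omega)), tau_shape_four, hy]
      refine le_pval_two_of_mul_eq 5 (y * (4 * k + 3) + 2 * k - 1) (by omega) ?_
      push_cast
      ring
  · have hb := (hclass hu.1 hu.2).resolve_left hs
    rw [not_or, not_or, not_or, not_or, not_or] at hs
    obtain ⟨h1, h2, h3, h4, h5, h6⟩ := hs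
    rw [if_neg (Ne.symm h1), if_neg (Ne.symm h2), if_neg (Ne.symm h3), if_neg (Ne.symm h4),
      if_neg (Ne.symm h5), if_neg (Ne.symm h6)]
    simpa using le_pval_two_tau hb

end
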